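/- Fix a base class F of next-token generators, a thinking length T ≥ 1, and κ ≥ 1. For any m ≥ 1 and any m points (x_1,z_1),…,(x_m,z_m) ∈ {0,1}* × {0,1}^T, the number of distinct behavior vectors |{(ℓ_{f_1,…,f_κ}(x_1,z_1), …, ℓ_{f_1,…,f_κ}(x_m,z_m)) : f_1,…,f_κ ∈ F with ete_{f_1}^T ≡ ⋯ ≡ ete_{f_κ}^T}| is at most (Γ_F(mT))^κ, where Γ_F is the growth function of F as a class of {0,1}-valued functions on {0,1}*. -/

import Mathlib

namespace CoTPaper

/-- Apply-and-append step of a next-token generator. -/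
def appendStep (f : List Bool → Bool) (z : List Bool) : List Bool := z ++ [f z]

/-- End-to-end function after `T` autoregressive steps. -/
def eteFn (f : List Bool → Bool) (T : ℕ) (x : List Bool) : Bool :=
  ((appendStep f)^[T] x).getLastD false

/-- Chain of thought: `CoT_f^T(x) = (ete_f^1(x),…,ete_f^T(x))`. -/
def cotFn (f : List Bool → Bool) (T : ℕ) (x : List Bool) : Fin T → Bool :=
  fun t => eteFn f ((t : ℕ) + 1) x

/-- Growth function of a class `F` of `{0,1}`-valued functions on `{0,1}^*`:
the maximum, over tuples of `m` points, of the number of behavior vectors of `F`. -/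
noncomputable def growthFn (F : Set (List Bool → Bool)) (m : ℕ) : ℕ :=
  sSup {c : ℕ | ∃ s : Fin m → List Bool,
    c = Set.ncard {v : Fin m → Bool | ∃ f ∈ F, v = fun i => f (s i)}}

theorem eteFn_succ (f : List Bool → Bool) (n : ℕ) (x : List Bool) :
    eteFn f (n + 1) x = f ((appendStep f)^[n] x) := by
  simp [eteFn, Function.iterate_succ_apply', appendStep]

/-- If every generated token agrees with `z`, whether the generator is run on its own output
or on the prefixes of `z`, then the generated strings are the prefixes of `z` appended to `x`. -/
theorem iterate_appendStep_eq {f : List Bool → Bool} {T : ℕ} {x : List Bool} {z : Fin T → Bool}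
    (h : ∀ t : Fin T, f ((appendStep f)^[t] x) = z t ∨ f (x ++ (List.ofFn z).take t) = z t)
    (n : ℕ) (hn : n ≤ T) : (appendStep f)^[n] x = x ++ (List.ofFn z).take n := by
  induction n with
  | zero => simp
  | succ n ih =>
    have ih := ih (by omega)
    have hf := h ⟨n, hn⟩
    simp only [ih, or_self] at hf
    rw [Function.iterate_succ_apply', ih, appendStep, hf, List.append_assoc,
      List.take_succ_eq_append_getElem (by simpa using hn), List.getElem_ofFn]

/-- A chain of thought equals `z` iff the generator predicts each token of `z` from the
preceding prefix. -/
theorem cotFn_eq_iff (f : List Bool → Bool) (T : ℕ) (x : List Bool) (z : Fin T → Bool) :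
    cotFn f T x = z ↔ ∀ t : Fin T, f (x ++ (List.ofFn z).take t) = z t := by
  simp only [funext_iff, cotFn, eteFn_succ]
  constructor
  · intro h t
    rw [← iterate_appendStep_eq (fun t => .inl (h t)) t t.2.le, h]
  · intro h t
    rw [iterate_appendStep_eq (fun t => .inr (h t)) t t.2.le, h]

theorem ncard_behavior_le_growthFn (F : Set (List Bool → Bool)) {n : ℕ} (s : Fin n → List Bool) :
    Set.ncard {v : Fin n → Bool | ∃ f ∈ F, v = fun i => f (s i)} ≤ growthFn F n := by
  refine le_csSup ⟨Nat.card (Fin n → Bool), ?_⟩ ⟨s, rfl⟩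
  rintro c ⟨s, rfl⟩
  exact Set.ncard_le_card _

theorem ncard_pi_const {α ι : Type*} [Fintype ι] (B : Set α) :
    Set.ncard {b : ι → α | ∀ j, b j ∈ B} = B.ncard ^ Fintype.card ι := by
  rw [← Nat.card_coe_set_eq, ← Nat.card_coe_set_eq]
  refine (Nat.card_congr (Equiv.subtypePiEquivPi (p := fun (_ : ι) a => a ∈ B))).trans ?_
  rw [Nat.card_pi, Finset.prod_const, Finset.card_univ]

/-- **Growth-function bound for the κ-thinker CoT loss class.**  For any base class `F`,
thinking length `T ≥ 1`, `κ ≥ 1`, `m ≥ 1` and any `m` points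
`(x_i, z_i) ∈ {0,1}^* × {0,1}^T`, the number of distinct behavior vectors
`(ℓ_{f_1,…,f_κ}(x_1,z_1),…,ℓ_{f_1,…,f_κ}(x_m,z_m))`, over tuples `f_1,…,f_κ ∈ F` with
identical end-to-end functions, is at most `(Γ_F(mT))^κ`, where
`ℓ_{f_1,…,f_κ}(x,z) = 1[CoT_{f_j}^T(x) ≠ z for every j]`. -/
theorem stmt7 (F : Set (List Bool → Bool)) (T κ : ℕ) (hT : 1 ≤ T) (hκ : 1 ≤ κ)
    (m : ℕ) (hm : 1 ≤ m) (p : Fin m → List Bool × (Fin T → Bool)) :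
    Set.ncard {v : Fin m → Bool | ∃ f : Fin κ → (List Bool → Bool),
        (∀ j, f j ∈ F) ∧ (∀ j j', eteFn (f j) T = eteFn (f j') T) ∧
        v = fun i => decide (∀ j, cotFn (f j) T (p i).1 ≠ (p i).2)}
      ≤ (growthFn F (m * T)) ^ κ := by
  set s : Fin (m * T) → List Bool := fun k =>
    (p (finProdFinEquiv.symm k).1).1 ++
      (List.ofFn (p (finProdFinEquiv.symm k).1).2).take (finProdFinEquiv.symm k).2 with hs
  set B : Set (Fin (m * T) → Bool) := {v | ∃ f ∈ F, v = fun i => f (s i)}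
  let loss : (Fin κ → Fin (m * T) → Bool) → Fin m → Bool := fun b i =>
    decide (∀ j, ¬ ∀ t : Fin T, b j (finProdFinEquiv (i, t)) = (p i).2 t)
  calc _ ≤ Set.ncard (loss '' {b | ∀ j, b j ∈ B}) := by
        refine Set.ncard_le_ncard ?_ (Set.toFinite _)
        rintro v ⟨f, hf, -, rfl⟩
        refine ⟨fun j k => f j (s k), fun j => ⟨f j, hf j, rfl⟩, ?_⟩
        funext i
        simp only [loss, hs, ne_eq, cotFn_eq_iff, Equiv.symm_apply_apply]
    _ ≤ Set.ncard {b : Fin κ → Fin (m * T) → Bool | ∀ j, b j ∈ B} :=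
        Set.ncard_image_le (Set.toFinite _)
    _ = B.ncard ^ κ := by rw [ncard_pi_const, Fintype.card_fin]
    _ ≤ _ := Nat.pow_le_pow_left (ncard_behavior_le_growthFn F s) κ

end CoTPaper
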